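/- Let G be a graph with root x that has a rooted immersion of W_4. Then the graph obtained from G by sausage reducing it (with the root carried along: if the root is identified with other vertices, the resulting vertex is the root) also has a rooted immersion of W_4. -/

import Mathlib

open scoped Classical

noncomputable section

namespace PaperW4

/-- A finite loopless undirected multigraph on ambient vertex type `V`:
a finite vertex set together with a multiset of (non-loop) edges supported on it. -/
structure MG (V : Type) where
  verts : Finset V
  edges : Multiset (Sym2 V)
  edge_support : ∀ e ∈ edges, ∀ v ∈ e, v ∈ verts
  loopless : ∀ e ∈ edges, ¬ e.IsDiag

variable {V : Type} {W : Type}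

/-- `δ_G(X)`: the edges of `G` with exactly one endpoint in `X`. -/
def cutEdges (G : MG V) (X : Finset V) : Multiset (Sym2 V) :=
  G.edges.filter fun e => ∃ u v, e = s(u, v) ∧ u ∈ X ∧ v ∉ X

/-- `d_G(X) = |δ_G(X)|`. -/
def dcut (G : MG V) (X : Finset V) : ℕ := (cutEdges G X).card

/-- The degree of a vertex: the number of edges incident with it. -/
def deg (G : MG V) (v : V) : ℕ := (G.edges.filter fun e => v ∈ e).card

/-- `e_G(u,v)`: the number of edges joining `u` and `v`. -/
def emult (G : MG V) (u v : V) : ℕ := G.edges.count s(u, v)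

/-- `G` is `k`-edge-connected: every edge-cut `δ(X)` with `∅ ≠ X ⊊ V(G)` has size `≥ k`. -/
def EdgeConn (G : MG V) (k : ℕ) : Prop :=
  ∀ X : Finset V, X ⊆ G.verts → X.Nonempty → X ≠ G.verts → k ≤ dcut G X

/-- `G` is internally `k`-edge-connected: every edge-cut with at least two vertices
on each side has size `≥ k`. -/
def InternallyEdgeConn (G : MG V) (k : ℕ) : Prop :=
  ∀ X : Finset V, X ⊆ G.verts → 2 ≤ X.card → 2 ≤ (G.verts \ X).card → k ≤ dcut G X

/-- Every vertex has degree three. -/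
def Cubic (G : MG V) : Prop := ∀ v ∈ G.verts, deg G v = 3

/-- The multiset of edges traversed by a walk, given as its list of vertices. -/
def walkEdges (l : List V) : Multiset (Sym2 V) :=
  (↑((l.zip l.tail).map fun p => s(p.1, p.2)) : Multiset (Sym2 V))

/-- `l` is (the vertex sequence of) a walk from `u` to `v`. -/
def IsWalk (l : List V) (u v : V) : Prop :=
  l.head? = some u ∧ l.getLast? = some v

/-- `G` is connected: any two of its vertices are joined by a trail in `G`. -/
def Connected (G : MG V) : Prop :=
  ∀ u ∈ G.verts, ∀ v ∈ G.verts,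
    ∃ l : List V, IsWalk l u v ∧ walkEdges l ≤ G.edges ∧ ∀ w ∈ l, w ∈ G.verts

/-- An immersion of the loopless multigraph with vertex type `W` and edge multiset `H`
into `G`, with terminal map `φ`: `φ` is injective, and to each edge `uv` of `H` is
assigned a walk in `G` from `φ u` to `φ v`, these walks being globally edge-disjoint. -/
def ImmersionVia (G : MG V) (H : Multiset (Sym2 W)) (φ : W → V) : Prop :=
  Function.Injective φ ∧ (∀ w : W, φ w ∈ G.verts) ∧
  ∃ P : Multiset (Sym2 W × List V),
    P.map Prod.fst = H ∧
    (∀ p ∈ P, ∃ u v : W, p.1 = s(u, v) ∧ IsWalk p.2 (φ u) (φ v)) ∧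
    (P.map fun p => walkEdges p.2).sum ≤ G.edges

/-- The edges of the wheel `W₄`: vertex `0` is the center, `1,2,3,4` the rim cycle. -/
def w4Edges : Multiset (Sym2 (Fin 5)) :=
  {s(0, 1), s(0, 2), s(0, 3), s(0, 4), s(1, 2), s(2, 3), s(3, 4), s(4, 1)}

/-- `G` has an immersion of `W₄`. -/
def HasW4Immersion (G : MG V) : Prop :=
  ∃ φ : Fin 5 → V, ImmersionVia G w4Edges φ

/-- `G` (rooted at `x`) has a rooted immersion of `W₄`: one in which the
center of `W₄` corresponds to `x`. -/
def HasRootedW4Immersion (G : MG V) (x : V) : Prop :=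
  ∃ φ : Fin 5 → V, φ 0 = x ∧ ImmersionVia G w4Edges φ

/-- The edges of `D_m`: roots are `0, 1`; vertices `2, 3` play the role of `y₀, y₁`;
there are `m - 2` parallel edges between the two roots. -/
def dmEdges (m : ℕ) : Multiset (Sym2 (Fin 4)) :=
  Multiset.replicate (m - 2) s(0, 1) + {s(0, 2), s(0, 3), s(1, 2), s(1, 3), s(2, 3)}

/-- `G` with roots `x0, x1` has a rooted immersion of `D_m`. -/
def HasRootedDmImmersion (G : MG V) (m : ℕ) (x0 x1 : V) : Prop :=
  ∃ φ : Fin 4 → V, φ 0 = x0 ∧ φ 1 = x1 ∧ ImmersionVia G (dmEdges m) φ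

/-- The edges of `K₄`. -/
def k4Edges : Multiset (Sym2 (Fin 4)) :=
  {s(0, 1), s(0, 2), s(0, 3), s(1, 2), s(1, 3), s(2, 3)}

/-- A nested chain of vertex sets `C 0 ⊂ C 1 ⊂ ⋯`, each obtained from the previous
by adding one vertex, all cuts having size exactly `k`. -/
def SegChain (G : MG V) (n : ℕ) (C : Fin (n + 1) → Finset V) (k : ℕ) : Prop :=
  (∀ i, C i ⊆ G.verts) ∧
  (∀ i : Fin n, C i.castSucc ⊆ C i.succ ∧ (C i.succ \ C i.castSucc).card = 1) ∧
  (∀ i, dcut G (C i) = k)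

/-- `G` has a segmentation of width `k` relative to `(X, Y)`. -/
def HasSegmentation (G : MG V) (X Y : Finset V) (k : ℕ) : Prop :=
  ∃ (n : ℕ) (C : Fin (n + 1) → Finset V),
    SegChain G n C k ∧ C 0 = X ∧ G.verts \ C (Fin.last n) = Y

/-- `λ_s(G) ≥ m`: every edge-cut separating `x0` from `x1` has size `≥ m`. -/
def LamSGe (G : MG V) (x0 x1 : V) (m : ℕ) : Prop :=
  ∀ X : Finset V, X ⊆ G.verts → x0 ∈ X → x1 ∉ X → m ≤ dcut G X

/-- `λ_n(G) ≥ m`: every edge-cut not separating `x0` from `x1` has size `≥ m`. -/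
def LamNGe (G : MG V) (x0 x1 : V) (m : ℕ) : Prop :=
  ∀ X : Finset V, X ⊆ G.verts → X.Nonempty → X ≠ G.verts →
    (x0 ∈ X ↔ x1 ∈ X) → m ≤ dcut G X

/-- `λ_n^i(G) ≥ m`: every internal edge-cut not separating `x0` from `x1` has size `≥ m`. -/
def LamNiGe (G : MG V) (x0 x1 : V) (m : ℕ) : Prop :=
  ∀ X : Finset V, X ⊆ G.verts → 2 ≤ X.card → 2 ≤ (G.verts \ X).card →
    (x0 ∈ X ↔ x1 ∈ X) → m ≤ dcut G X

/-- The subgraph of `G` induced on `S`. -/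
def induce (G : MG V) (S : Finset V) : MG V where
  verts := G.verts ∩ S
  edges := G.edges.filter fun e => ∀ v ∈ e, v ∈ S
  edge_support := by
    intro e he v hv
    rw [Multiset.mem_filter] at he
    exact Finset.mem_inter.mpr ⟨G.edge_support e he.1 v hv, he.2 v hv⟩
  loopless := fun e he => G.loopless e (Multiset.mem_of_mem_filter he)

/-- `G` with the vertices of `S` (and all incident edges) deleted. -/
def deleteVerts (G : MG V) (S : Finset V) : MG V := induce G (G.verts \ S)

/-- `C` is (the vertex set of) a connected component of `G`. -/
def IsComponent (G : MG V) (C : Finset V) : Prop :=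
  C ⊆ G.verts ∧ C.Nonempty ∧ Connected (induce G C) ∧
  ∀ e ∈ G.edges, (∃ v ∈ e, v ∈ C) → ∀ v ∈ e, v ∈ C

/-- `G` has type `A_m` with respect to roots `x0, x1`. -/
def TypeA (G : MG V) (m : ℕ) (x0 x1 : V) : Prop :=
  ∃ X0 X1 : Finset V, x0 ∈ X0 ∧ x1 ∈ X1 ∧ X0.card ≤ 2 ∧ X1.card ≤ 2 ∧
    HasSegmentation G X0 X1 m

/-- The edges of the lobe of `G` (with roots `x0, x1`) corresponding to the
component `C` of `G ∖ {x0, x1}`: edges inside `C ∪ {x0, x1}` other than `x0x1`-edges. -/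
def lobeEdges (G : MG V) (C : Finset V) (x0 x1 : V) : Multiset (Sym2 V) :=
  G.edges.filter fun e => (∀ v ∈ e, v ∈ insert x0 (insert x1 C)) ∧ e ≠ s(x0, x1)

/-- `G` has type `B_m` with respect to roots `x0, x1`. -/
def TypeB (G : MG V) (m : ℕ) (x0 x1 : V) : Prop :=
  ∃ (k : ℕ) (C : Fin k → Finset V) (nL : Fin k → ℕ),
    Function.Injective C ∧
    (∀ D : Finset V, IsComponent (deleteVerts G {x0, x1}) D ↔ ∃ i, C i = D) ∧
    (∀ i : Fin k, 2 ≤ nL i ∧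
      ∃ l : List V, l.Nodup ∧ IsWalk l x0 x1 ∧
        l.toFinset = insert x0 (insert x1 (C i)) ∧
        (2 ≤ (C i).card → nL i = 2) ∧
        lobeEdges G (C i) x0 x1 = nL i • walkEdges l) ∧
    emult G x0 x1 + ∑ i, nL i = m + 1

/-- The edge multiset of a cycle of length `n` on the vertices `f 0, f 1, …`. -/
def cycleEdges (n : ℕ) (f : Fin n → V) : Multiset (Sym2 V) :=
  (Finset.univ.val : Multiset (Fin n)).map fun i =>
    s(f i, f ⟨(i.val + 1) % n, Nat.mod_lt _ i.pos⟩)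

/-- `G` is a doubled cycle of length `n`. -/
def IsDoubledCycleLen (G : MG V) (n : ℕ) : Prop :=
  ∃ f : Fin n → V, Function.Injective f ∧ Finset.univ.image f = G.verts ∧
    G.edges = 2 • cycleEdges n f

/-- `G` is a doubled cycle. -/
def IsDoubledCycle (G : MG V) : Prop := ∃ n, 3 ≤ n ∧ IsDoubledCycleLen G n

/-- The map collapsing all of `Y` to the vertex `y0` and fixing everything else. -/
def collapseFun (Y : Finset V) (y0 : V) : V → V := fun v => if v ∈ Y then y0 else v

/-- The image multigraph of `G` under a vertex map `f` (identification of vertices),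
with any created loops deleted. -/
def mapGraph (f : V → V) (G : MG V) : MG V where
  verts := G.verts.image f
  edges := (G.edges.map (Sym2.map f)).filter fun e => ¬e.IsDiag
  edge_support := by
    intro e he v hv
    rw [Multiset.mem_filter] at he
    obtain ⟨he, -⟩ := he
    rw [Multiset.mem_map] at he
    obtain ⟨e', he', rfl⟩ := he
    rw [Sym2.mem_map] at hv
    obtain ⟨u, hu, rfl⟩ := hv
    exact Finset.mem_image_of_mem f (G.edge_support e' he' u hu)
  loopless := by
    intro e he
    rw [Multiset.mem_filter] at he
    exact he.2

/-- `G[X]` is a chain of sausages of order `k` in `G`: identifying `V(G) ∖ X` to a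
single vertex yields a doubled cycle of length `k + 1`. -/
def ChainOfSausages (G : MG V) (X : Finset V) (k : ℕ) : Prop :=
  X ⊆ G.verts ∧ X.card = k ∧ 2 ≤ k ∧
  ∃ y0 ∈ G.verts \ X,
    IsDoubledCycleLen (mapGraph (collapseFun (G.verts \ X) y0) G) (k + 1)

/-- `G` is sausage reduced: it has no chain of sausages of order at least `3`. -/
def SausageReduced (G : MG V) : Prop :=
  ¬ ∃ (X : Finset V) (k : ℕ), 3 ≤ k ∧ ChainOfSausages G X k

/-- One sausage shortening step of a rooted graph: two adjacent vertices of a chain of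
sausages of order at least three are identified, carrying the root along. -/
def RootedShortStep (p q : MG V × V) : Prop :=
  ∃ (X : Finset V) (k : ℕ) (a b : V),
    3 ≤ k ∧ ChainOfSausages p.1 X k ∧ a ∈ X ∧ b ∈ X ∧ a ≠ b ∧ s(a, b) ∈ p.1.edges ∧
    q.1 = mapGraph (fun v => if v = b then a else v) p.1 ∧
    q.2 = (if p.2 = b then a else p.2)

/-- Deleting a single copy of the edge `e` from `G`. -/
def deleteEdge (G : MG V) (e : Sym2 V) : MG V where
  verts := G.verts
  edges := G.edges.erase e
  edge_support := fun e' he' => G.edge_support e' (Multiset.mem_of_mem_erase he')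
  loopless := fun e' he' => G.loopless e' (Multiset.mem_of_mem_erase he')

/-- `G` has a tree-decomposition of width at most `k`. -/
def HasTreeDecomp (G : MG V) (k : ℕ) : Prop :=
  ∃ (ι : Type) (T : SimpleGraph ι) (B : ι → Finset V),
    T.IsTree ∧
    (∀ t, B t ⊆ G.verts) ∧
    (∀ v ∈ G.verts, ∃ t, v ∈ B t) ∧
    (∀ e ∈ G.edges, ∃ t, ∀ v ∈ e, v ∈ B t) ∧
    (∀ v ∈ G.verts, (SimpleGraph.induce {t | v ∈ B t} T).Connected) ∧
    ∀ t, (B t).card ≤ k + 1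

/-- The tree-width of `G`. -/
def treewidth (G : MG V) : ℕ := sInf { k | HasTreeDecomp G k }

/-- One subdivision step: an edge `uv` is replaced by a path `u - w - v`
through a new vertex `w`. -/
def SubdivStep (G H : MG V) : Prop :=
  ∃ u v w : V, s(u, v) ∈ G.edges ∧ w ∉ G.verts ∧
    H.verts = insert w G.verts ∧
    H.edges = (G.edges.erase s(u, v)) + {s(u, w), s(w, v)}

/-- `H` is a subdivision of `G`. -/
def IsSubdivision (G H : MG V) : Prop := Relation.ReflTransGen SubdivStep G H

/-- `G`, rooted at `u`, has type 2 (for the rooted `W₄` theorem). -/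
def TypeTwo (G : MG V) (u : V) : Prop :=
  ∃ W0 : Finset V, W0 ⊆ G.verts ∧ u ∉ W0 ∧ 1 ≤ W0.card ∧ W0.card ≤ 2 ∧
    ∃ w0 ∈ W0,
      ∃ n : ℕ, 3 ≤ n ∧
        ∃ f : Fin n → V,
          Function.Injective f ∧
          Finset.univ.image f = (mapGraph (collapseFun W0 w0) G).verts ∧
          (∃ i, f i = u) ∧ (∃ j, f j = w0) ∧
          ((s(u, w0) ∉ cycleEdges n f ∧
              (mapGraph (collapseFun W0 w0) G).edges =
                2 • cycleEdges n f + {s(u, w0)}) ∨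
           (∃ v : V, s(u, v) ∈ cycleEdges n f ∧ s(v, w0) ∈ cycleEdges n f ∧
              (mapGraph (collapseFun W0 w0) G).edges =
                2 • cycleEdges n f + {s(u, v), s(v, w0)}) ∨
           (s(u, w0) ∈ cycleEdges n f ∧
              (mapGraph (collapseFun W0 w0) G).edges =
                2 • cycleEdges n f + {s(u, w0)}))

theorem MG.ext' {G H : MG V} (hv : G.verts = H.verts) (he : G.edges = H.edges) : G = H := by
  cases G; cases H; simp_all

theorem walkEdges_cons_cons (a b : V) (l : List V) :
    walkEdges (a :: b :: l) = s(a, b) ::ₘ walkEdges (b :: l) := by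
  simp [walkEdges]

theorem walkEdges_map (g : V → V) (l : List V) :
    walkEdges (l.map g) = (walkEdges l).map (Sym2.map g) := by
  induction l with
  | nil => simp [walkEdges]
  | cons a l ih =>
    cases l with
    | nil => simp [walkEdges]
    | cons b l =>
      simp only [List.map_cons] at ih ⊢
      rw [walkEdges_cons_cons, walkEdges_cons_cons, ih]
      simp

/-- Removing the immediate repetitions from a walk deletes exactly its loops. -/
theorem exists_loopless_walk (l : List V) :
    ∃ l' : List V, l'.head? = l.head? ∧ l'.getLast? = l.getLast? ∧
      walkEdges l' = (walkEdges l).filter fun e => ¬ e.IsDiag := by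
  induction l with
  | nil => exact ⟨[], rfl, rfl, by simp [walkEdges]⟩
  | cons a l ih =>
    cases l with
    | nil => exact ⟨[a], rfl, rfl, by simp [walkEdges]⟩
    | cons b l =>
      obtain ⟨l', h1, h2, h3⟩ := ih
      rw [walkEdges_cons_cons]
      by_cases hab : a = b
      · subst hab
        exact ⟨l', h1, by simpa using h2, by simpa using h3⟩
      · cases l' with
        | nil => simp at h1
        | cons b' t =>
          obtain rfl : b' = b := by simpa using h1
          refine ⟨a :: b' :: t, rfl, by simpa using h2, ?_⟩
          rw [walkEdges_cons_cons, h3, Multiset.filter_cons_of_pos _ (by simpa using hab)]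

/-- Identifying vertices preserves an immersion as long as no two terminals are identified. -/
theorem ImmersionVia.mapGraph {G : MG V} {H : Multiset (Sym2 W)} {φ : W → V} (g : V → V)
    (h : ImmersionVia G H φ) (hinj : Function.Injective (g ∘ φ)) :
    ImmersionVia (mapGraph g G) H (g ∘ φ) := by
  obtain ⟨-, hv, P, hP, hw, hle⟩ := h
  choose T hT1 hT2 hT3 using fun l : List V => exists_loopless_walk (l.map g)
  let F : Multiset (Sym2 V) →+ Multiset (Sym2 V) :=
    { toFun := fun s => (s.map (Sym2.map g)).filter fun e => ¬ e.IsDiag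
      map_zero' := by simp
      map_add' := by simp }
  refine ⟨hinj, fun w => Finset.mem_image_of_mem g (hv w),
    P.map fun p => (p.1, T p.2), ?_, ?_, ?_⟩
  · simpa [Multiset.map_map, Function.comp_def] using hP
  · intro p hp
    obtain ⟨p, hp', rfl⟩ := Multiset.mem_map.1 hp
    obtain ⟨u, v, huv, h1, h2⟩ := hw p hp'
    exact ⟨u, v, huv, by simp [hT1, h1], by simp [hT2, h2]⟩
  · have : ((P.map fun p => (p.1, T p.2)).map fun p => walkEdges p.2).sum =
        F (P.map fun p => walkEdges p.2).sum := by
      rw [map_multiset_sum, Multiset.map_map, Multiset.map_map]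
      congr 1
      refine Multiset.map_congr rfl fun p _ => ?_
      simp only [Function.comp_apply, hT3, walkEdges_map]
      rfl
    rw [this]
    exact Multiset.filter_le_filter _ (Multiset.map_le_map hle)

/-- The edge `e` has exactly one endpoint in `S`. -/
def Crosses (S : Set V) (e : Sym2 V) : Prop := ∃ u v, e = s(u, v) ∧ u ∈ S ∧ v ∉ S

theorem crosses_mk (S : Set V) (u v : V) : Crosses S s(u, v) ↔ ¬ (u ∈ S ↔ v ∈ S) := by
  constructor
  · rintro ⟨u', v', h, hu, hv⟩
    rcases Sym2.eq_iff.1 h with ⟨rfl, rfl⟩ | ⟨rfl, rfl⟩ <;> tauto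
  · intro h
    by_cases hu : u ∈ S
    · exact ⟨u, v, rfl, hu, by tauto⟩
    · exact ⟨v, u, Sym2.eq_swap, by tauto, hu⟩

theorem Crosses.not_isDiag {S : Set V} {e : Sym2 V} (h : Crosses S e) : ¬ e.IsDiag := by
  obtain ⟨u, v, rfl, hu, hv⟩ := h
  rw [Sym2.mk_isDiag_iff]
  rintro rfl
  exact hv hu

theorem dcut_eq_card_crosses (G : MG V) (S : Finset V) :
    dcut G S = (G.edges.filter (Crosses (S : Set V))).card := by
  rfl

theorem IsWalk.exists_crosses {S : Set V} {l : List V} {u v : V} (h : IsWalk l u v)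
    (huv : ¬ (u ∈ S ↔ v ∈ S)) : ∃ e ∈ walkEdges l, Crosses S e := by
  induction l generalizing u with
  | nil => simp [IsWalk] at h
  | cons a l ih =>
    obtain ⟨h1, h2⟩ := h
    obtain rfl : a = u := by simpa using h1
    cases l with
    | nil =>
      obtain rfl : a = v := by simpa using h2
      simp at huv
    | cons b l =>
      rw [walkEdges_cons_cons]
      by_cases hab : a ∈ S ↔ b ∈ S
      · obtain ⟨e, he, hc⟩ := ih (u := b) ⟨rfl, by simpa using h2⟩ (by rwa [← hab])
        exact ⟨e, Multiset.mem_cons_of_mem he, hc⟩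
      · exact ⟨_, Multiset.mem_cons_self _ _, (crosses_mk S a b).2 hab⟩

/-- A cut of `G` is at least as large as the cut it induces on an immersed graph. -/
theorem ImmersionVia.card_crosses_le {G : MG V} {H : Multiset (Sym2 W)} {φ : W → V}
    (h : ImmersionVia G H φ) (S : Finset V) :
    (H.filter (Crosses (φ ⁻¹' S))).card ≤ dcut G S := by
  obtain ⟨-, -, P, rfl, hw, hle⟩ := h
  rw [dcut_eq_card_crosses]
  refine le_trans ?_ (Multiset.card_le_card (Multiset.filter_le_filter _ hle))
  clear hle
  induction P using Multiset.induction_on with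
  | empty => simp
  | cons p P ih =>
    have ih := ih fun q hq => hw q (Multiset.mem_cons_of_mem hq)
    simp only [Multiset.map_cons, Multiset.sum_cons, Multiset.filter_add, Multiset.card_add]
    by_cases hp : Crosses (φ ⁻¹' S) p.1
    · rw [Multiset.filter_cons_of_pos _ hp, Multiset.card_cons]
      obtain ⟨u, v, huv, hwalk⟩ := hw p (Multiset.mem_cons_self _ _)
      rw [huv, crosses_mk] at hp
      obtain ⟨e, he, hc⟩ := hwalk.exists_crosses (S := (S : Set V)) hp
      have : 0 < ((walkEdges p.2).filter (Crosses (S : Set V))).card :=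
        Multiset.card_pos_iff_exists_mem.2 ⟨e, Multiset.mem_filter.2 ⟨he, hc⟩⟩
      omega
    · rw [Multiset.filter_cons_of_neg _ hp]
      omega

/-- The size of the cut of `W₄` given by a two-colouring of its vertices. -/
def w4Cut (q : Fin 5 → Bool) : ℕ :=
  (q 0 ^^ q 1).toNat + (q 0 ^^ q 2).toNat + (q 0 ^^ q 3).toNat + (q 0 ^^ q 4).toNat +
    (q 1 ^^ q 2).toNat + (q 2 ^^ q 3).toNat + (q 3 ^^ q 4).toNat + (q 4 ^^ q 1).toNat

theorem w4Cut_eq_card_crosses (q : Fin 5 → Bool) :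
    w4Cut q = (w4Edges.filter (Crosses {i | q i = true})).card := by
  have key : ∀ i j : Fin 5, (q i ^^ q j).toNat =
      (Multiset.filter (Crosses {i | q i = true}) {s(i, j)}).card := by
    intro i j
    rw [Multiset.filter_singleton]
    rcases Bool.eq_false_or_eq_true (q i) with hi | hi <;>
      rcases Bool.eq_false_or_eq_true (q j) with hj | hj <;> simp [crosses_mk, hi, hj]
  simp only [w4Cut, key, ← Multiset.card_add, ← Multiset.filter_add]
  rfl

theorem ImmersionVia.w4Cut_le {G : MG V} {φ : Fin 5 → V} (h : ImmersionVia G w4Edges φ)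
    (S : Finset V) (q : Fin 5 → Bool) (hq : ∀ i, q i = true ↔ φ i ∈ S) :
    w4Cut q ≤ dcut G S := by
  have hS : (φ ⁻¹' S : Set (Fin 5)) = {i | q i = true} := by ext i; simp [hq]
  rw [w4Cut_eq_card_crosses, ← hS]
  exact h.card_crosses_le S

theorem w4Cut_pair : ∀ i j : Fin 5, i ≠ j → w4Cut (fun t => t == i || t == j) ≤ 4 →
    i ≠ 0 ∧ j ≠ 0 := by
  decide

theorem not_w4Cut_triple : ∀ i j l : Fin 5, i ≠ j → i ≠ l → j ≠ l → i ≠ 0 → j ≠ 0 → l ≠ 0 →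
    ¬ w4Cut (fun t => t == i || t == j || t == l) ≤ 4 := by
  decide

/-- `u, v, w` are consecutive vertices of a chain of sausages, up to what is needed for shortening:
`v` has only the doubled edges to `u` and `w`, and intervals of `u, v, w` have cuts of size
at most four. -/
structure Consecutive (G : MG V) (u v w : V) : Prop where
  mem_left : u ∈ G.verts
  mem_mid : v ∈ G.verts
  mem_right : w ∈ G.verts
  ne_left : u ≠ v
  ne_right : v ≠ w
  ne_ends : u ≠ w
  edges_mid : (G.edges.filter fun e => v ∈ e) = 2 • {s(u, v), s(v, w)}
  cut_left : dcut G {u, v} ≤ 4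
  cut_right : dcut G {v, w} ≤ 4
  cut_all : dcut G {u, v, w} ≤ 4

theorem Consecutive.symm {G : MG V} {u v w : V} (h : Consecutive G u v w) :
    Consecutive G w v u where
  mem_left := h.mem_right
  mem_mid := h.mem_mid
  mem_right := h.mem_left
  ne_left := h.ne_right.symm
  ne_right := h.ne_left.symm
  ne_ends := h.ne_ends.symm
  edges_mid := by
    rw [h.edges_mid, Multiset.pair_comm, Sym2.eq_swap (a := u), Sym2.eq_swap (a := v)]
  cut_left := by rw [Finset.pair_comm]; exact h.cut_right
  cut_right := by rw [Finset.pair_comm]; exact h.cut_left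
  cut_all := by
    have : ({w, v, u} : Finset V) = {u, v, w} := by ext; simp; tauto
    rw [this]; exact h.cut_all

theorem ImmersionVia.ne_zero_of_dcut_pair_le {G : MG V} {φ : Fin 5 → V}
    (h : ImmersionVia G w4Edges φ) {i j : Fin 5} (hij : i ≠ j)
    (hcut : dcut G {φ i, φ j} ≤ 4) : i ≠ 0 ∧ j ≠ 0 :=
  w4Cut_pair i j hij <| (h.w4Cut_le {φ i, φ j} _ fun t => by simp [h.1.eq_iff]).trans hcut

/-- Two terminals at consecutive vertices are both rim vertices, and the third consecutive
vertex is not a terminal. -/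
theorem Consecutive.terminals {G : MG V} {φ : Fin 5 → V} (h : ImmersionVia G w4Edges φ)
    {i j : Fin 5} {w : V} (hc : Consecutive G (φ i) (φ j) w) :
    i ≠ 0 ∧ j ≠ 0 ∧ ∀ l, φ l ≠ w := by
  have hij : i ≠ j := fun e => hc.ne_left (congrArg φ e)
  obtain ⟨hi, hj⟩ := h.ne_zero_of_dcut_pair_le hij hc.cut_left
  refine ⟨hi, hj, ?_⟩
  rintro l rfl
  have hjl : j ≠ l := fun e => hc.ne_right (congrArg φ e)
  have hil : i ≠ l := fun e => hc.ne_ends (congrArg φ e)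
  exact not_w4Cut_triple i j l hij hil hjl hi hj (h.ne_zero_of_dcut_pair_le hjl hc.cut_right).2 <|
    (h.w4Cut_le {φ i, φ j, φ l} _ fun t => by simp [h.1.eq_iff, or_assoc]).trans hc.cut_all

theorem mapGraph_congr {G : MG V} {g₁ g₂ : V → V} (v : V)
    (hverts : G.verts.image g₁ = G.verts.image g₂) (hg : ∀ z, z ≠ v → g₁ z = g₂ z)
    (hv : (((G.edges.filter fun e => v ∈ e).map (Sym2.map g₁)).filter fun e => ¬ e.IsDiag) =
      ((G.edges.filter fun e => v ∈ e).map (Sym2.map g₂)).filter fun e => ¬ e.IsDiag) :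
    mapGraph g₁ G = mapGraph g₂ G := by
  refine MG.ext' hverts ?_
  have hrest : (G.edges.filter fun e => ¬ v ∈ e).map (Sym2.map g₁) =
      (G.edges.filter fun e => ¬ v ∈ e).map (Sym2.map g₂) := by
    refine Multiset.map_congr rfl fun e he => ?_
    have hve := (Multiset.mem_filter.1 he).2
    exact Sym2.map_congr fun z hz => hg z fun hzv => hve (hzv ▸ hz)
  simp only [mapGraph]
  rw [← Multiset.filter_add_not (fun e => v ∈ e) G.edges]
  simp only [Multiset.map_add, Multiset.filter_add, hv, hrest]

theorem image_identify {s : Finset V} {a b : V} (ha : a ∈ s) (hab : a ≠ b) :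
    s.image (fun v => if v = b then a else v) = s.erase b := by
  ext z
  simp only [Finset.mem_image, Finset.mem_erase]
  constructor
  · rintro ⟨t, ht, rfl⟩
    split_ifs with h
    · exact ⟨hab, ha⟩
    · exact ⟨h, ht⟩
  · rintro ⟨hz, hzs⟩
    exact ⟨z, hzs, if_neg hz⟩

theorem image_shift {s : Finset V} {a b c : V} (ha : a ∈ s) (hb : b ∈ s) (hc : c ∈ s)
    (hab : a ≠ b) (hcb : c ≠ b) :
    s.image (fun v => if v = b then a else if v = a then c else v) = s.erase b := by
  ext z
  simp only [Finset.mem_image, Finset.mem_erase]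
  constructor
  · rintro ⟨t, ht, rfl⟩
    split_ifs with h h'
    · exact ⟨hab, ha⟩
    · exact ⟨hcb, hc⟩
    · exact ⟨h, ht⟩
  · rintro ⟨hz, hzs⟩
    by_cases hza : z = a
    · exact ⟨b, hb, by simp [hza]⟩
    · exact ⟨z, hzs, by simp [hz, hza]⟩

/-- For consecutive vertices `a, b, c`, identifying `b` with `a` or with `c` is the same. -/
theorem Consecutive.mapGraph_identify {G : MG V} {a b c : V} (h : Consecutive G a b c) :
    mapGraph (fun v => if v = b then a else v) G =
      mapGraph (fun v => if v = b then c else v) G := by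
  refine mapGraph_congr b ?_ (fun z hz => by simp [hz]) ?_
  · rw [image_identify h.mem_left h.ne_left, image_identify h.mem_right h.ne_right.symm]
  · rw [h.edges_mid]
    simp [two_nsmul, Multiset.filter_singleton, h.ne_left, h.ne_right.symm, h.ne_ends]

/-- For consecutive vertices `b, a, c`, identifying `b` with `a` is the same as identifying
`a` with `c` and renaming `b` to `a`. -/
theorem Consecutive.mapGraph_shift {G : MG V} {a b c : V} (h : Consecutive G b a c) :
    mapGraph (fun v => if v = b then a else v) G =
      mapGraph (fun v => if v = b then a else if v = a then c else v) G := by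
  refine mapGraph_congr a ?_ (fun z hz => by simp [hz]) ?_
  · rw [image_identify h.mem_mid h.ne_left.symm,
      image_shift h.mem_mid h.mem_left h.mem_right h.ne_left.symm h.ne_ends.symm]
  · rw [h.edges_mid]
    simp [two_nsmul, Multiset.filter_singleton, h.ne_left.symm, h.ne_right, h.ne_ends.symm,
      h.ne_right.symm]

theorem cycleEdges_succ (k : ℕ) (f : Fin (k + 1) → V) :
    cycleEdges (k + 1) f = (Finset.univ.val : Multiset (Fin (k + 1))).map fun i =>
      s(f i, f (i + 1)) := by
  refine Multiset.map_congr rfl fun i _ => ?_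
  congr 3
  simp

theorem filter_cycleEdges (k : ℕ) (f : Fin (k + 1) → V) (Q : Sym2 V → Prop) [DecidablePred Q]
    {s : Finset (Fin (k + 1))} (hs : ∀ i, i ∈ s ↔ Q s(f i, f (i + 1))) :
    (cycleEdges (k + 1) f).filter Q = s.val.map fun i => s(f i, f (i + 1)) := by
  have : s = Finset.univ.filter fun i => Q s(f i, f (i + 1)) := by ext i; simp [hs]
  rw [cycleEdges_succ, Multiset.filter_map, this]
  rfl

theorem card_filter_cycleEdges_le (k : ℕ) (f : Fin (k + 1) → V) (Q : Sym2 V → Prop)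
    [DecidablePred Q] {i j : Fin (k + 1)} (hs : ∀ l, Q s(f l, f (l + 1)) → l = i ∨ l = j) :
    ((cycleEdges (k + 1) f).filter Q).card ≤ 2 := by
  rw [filter_cycleEdges k f Q (s := Finset.univ.filter fun i => Q s(f i, f (i + 1))) (by simp),
    Multiset.card_map]
  refine le_trans (Finset.card_le_card (t := {i, j}) fun l hl => ?_) Finset.card_le_two
  simpa using hs l (Finset.mem_filter.1 hl).2

theorem cycleEdges_filter_mem {k : ℕ} (hk : 1 ≤ k) {f : Fin (k + 1) → V}
    (hf : Function.Injective f) (i : Fin (k + 1)) :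
    ((cycleEdges (k + 1) f).filter fun e => f (i + 1) ∈ e) =
      {s(f i, f (i + 1)), s(f (i + 1), f (i + 1 + 1))} := by
  have h1 : (1 : Fin (k + 1)) ≠ 0 := by
    intro h
    have := congrArg Fin.val h
    simp at this
    omega
  rw [filter_cycleEdges k f _ (s := {i, i + 1}),
    Finset.insert_val_of_notMem (by simpa using h1)]
  · simp
  · intro j
    simp only [Sym2.mem_iff, hf.eq_iff, add_left_inj, Finset.mem_insert, Finset.mem_singleton]
    tauto

theorem card_cycleEdges_filter_pair {k : ℕ} {f : Fin (k + 1) → V}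
    (hf : Function.Injective f) (i : Fin (k + 1)) :
    ((cycleEdges (k + 1) f).filter
      (Crosses (({f (i + 1), f (i + 1 + 1)} : Finset V) : Set V))).card ≤ 2 := by
  refine card_filter_cycleEdges_le k f _ (i := i) (j := i + 1 + 1) fun j => ?_
  simp only [crosses_mk, Finset.mem_coe, hf.eq_iff, add_left_inj, Finset.mem_insert,
    Finset.mem_singleton]
  tauto

theorem card_cycleEdges_filter_triple {k : ℕ} {f : Fin (k + 1) → V}
    (hf : Function.Injective f) (i : Fin (k + 1)) :
    ((cycleEdges (k + 1) f).filter
      (Crosses (({f (i + 1), f (i + 1 + 1), f (i + 1 + 1 + 1)} : Finset V) : Set V))).card ≤ 2 := by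
  refine card_filter_cycleEdges_le k f _ (i := i) (j := i + 1 + 1 + 1) fun j => ?_
  simp only [crosses_mk, Finset.mem_coe, hf.eq_iff, add_left_inj, Finset.mem_insert,
    Finset.mem_singleton]
  tauto

section Collapse

variable {G : MG V} {X : Finset V} {y₀ : V}

theorem collapseFun_eq_self {v : V} (hv : v ∈ X) : collapseFun (G.verts \ X) y₀ v = v := by
  simp [collapseFun, hv]

theorem collapseFun_eq_iff (hy : y₀ ∉ X) {v w : V} (hw : w ∈ X) :
    collapseFun (G.verts \ X) y₀ v = w ↔ v = w := by
  unfold collapseFun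
  split_ifs with h
  · constructor
    · rintro rfl; exact absurd hw hy
    · rintro rfl; simp [hw] at h
  · rfl

theorem collapse_eq_mk (hy : y₀ ∉ X) {u v : V} (hu : u ∈ X) (hv : v ∈ X) {e : Sym2 V}
    (he : Sym2.map (collapseFun (G.verts \ X) y₀) e = s(u, v)) : e = s(u, v) := by
  induction e with
  | h p q =>
    rw [Sym2.map_mk, Sym2.eq_iff] at he
    simp only [collapseFun_eq_iff hy hu, collapseFun_eq_iff hy hv] at he
    exact Sym2.eq_iff.2 he

theorem mem_map_collapse_iff (hy : y₀ ∉ X) {v : V} (hv : v ∈ X) (e : Sym2 V) :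
    v ∈ Sym2.map (collapseFun (G.verts \ X) y₀) e ↔ v ∈ e := by
  simp only [Sym2.mem_map, collapseFun_eq_iff hy hv, exists_eq_right]

theorem crosses_collapse (hy : y₀ ∉ X) {S : Finset V} (hS : S ⊆ X) (e : Sym2 V) :
    Crosses (S : Set V) (Sym2.map (collapseFun (G.verts \ X) y₀) e) ↔ Crosses (S : Set V) e := by
  have key : ∀ v, collapseFun (G.verts \ X) y₀ v ∈ S ↔ v ∈ S := fun v =>
    ⟨fun h => by rwa [← (collapseFun_eq_iff hy (hS h)).1 rfl] at h,
      fun h => by rwa [collapseFun_eq_self (hS h)]⟩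
  induction e with
  | h p q => simp [crosses_mk, key]

theorem dcut_collapse (hy : y₀ ∉ X) {S : Finset V} (hS : S ⊆ X) :
    dcut (mapGraph (collapseFun (G.verts \ X) y₀) G) S = dcut G S := by
  rw [dcut_eq_card_crosses, dcut_eq_card_crosses]
  simp only [mapGraph]
  rw [Multiset.filter_filter, Multiset.filter_map, Multiset.card_map]
  congr 1
  refine Multiset.filter_congr fun e _ => ?_
  rw [Function.comp_apply, crosses_collapse hy hS, and_iff_left_iff_imp,
    ← crosses_collapse (G := G) hy hS]
  exact Crosses.not_isDiag

theorem collapse_filter_mem (hy : y₀ ∉ X) {v : V} (hv : v ∈ X) :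
    ((mapGraph (collapseFun (G.verts \ X) y₀) G).edges.filter fun e => v ∈ e) =
      (G.edges.filter fun e => v ∈ e).map (Sym2.map (collapseFun (G.verts \ X) y₀)) := by
  simp only [mapGraph]
  rw [Multiset.filter_filter, Multiset.filter_map]
  congr 1
  refine Multiset.filter_congr fun e he => ?_
  simp only [Function.comp_apply, mem_map_collapse_iff hy hv, and_iff_left_iff_imp]
  have hl := G.loopless e he
  induction e with
  | h p q =>
    intro hve
    rw [Sym2.map_mk, Sym2.mk_isDiag_iff]
    rw [Sym2.mk_isDiag_iff] at hl
    rcases Sym2.mem_iff.1 hve with rfl | rfl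
    · rw [collapseFun_eq_self hv, eq_comm, collapseFun_eq_iff hy hv]
      exact Ne.symm hl
    · rwa [collapseFun_eq_self hv, collapseFun_eq_iff hy hv]

theorem consecutive_of_collapse {k : ℕ} (hX : X ⊆ G.verts) (hy : y₀ ∉ X) (hk : 2 ≤ k)
    {f : Fin (k + 1) → V} (hf : Function.Injective f)
    (he : (mapGraph (collapseFun (G.verts \ X) y₀) G).edges = 2 • cycleEdges (k + 1) f)
    (i : Fin (k + 1)) (h0 : f i ∈ X) (h1 : f (i + 1) ∈ X) (h2 : f (i + 1 + 1) ∈ X) :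
    Consecutive G (f i) (f (i + 1)) (f (i + 1 + 1)) := by
  have hcut : ∀ S : Finset V, S ⊆ X →
      ((cycleEdges (k + 1) f).filter (Crosses (S : Set V))).card ≤ 2 → dcut G S ≤ 4 := by
    intro S hS hc
    rw [← dcut_collapse hy hS, dcut_eq_card_crosses, he, Multiset.filter_nsmul,
      Multiset.card_nsmul]
    omega
  have e1 : (1 : Fin (k + 1)) ≠ 0 := by
    intro h
    have := congrArg Fin.val h
    simp at this
    omega
  have e2 : (1 + 1 : Fin (k + 1)) ≠ 0 := by
    intro h
    have := congrArg Fin.val h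
    rw [Fin.val_add, Fin.val_one', Nat.mod_eq_of_lt (by omega : 1 < k + 1),
      Nat.mod_eq_of_lt (by omega)] at this
    simp at this
  obtain ⟨j, rfl⟩ : ∃ j, i = j + 1 := ⟨i - 1, by simp⟩
  refine ⟨hX h0, hX h1, hX h2, ?_, ?_, ?_, ?_, ?_, ?_, ?_⟩
  · simpa [hf.eq_iff] using e1
  · simpa [hf.eq_iff] using e1
  · rw [Ne, hf.eq_iff, add_assoc (j + 1)]
    simpa using e2
  · have key := collapse_filter_mem (G := G) hy h1
    rw [he, Multiset.filter_nsmul, cycleEdges_filter_mem (by omega) hf] at key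
    rw [key]
    conv_lhs => rw [← Multiset.map_id (Multiset.filter _ _)]
    refine Multiset.map_congr rfl fun e hmem => ?_
    have hmem := Multiset.mem_map_of_mem (Sym2.map (collapseFun (G.verts \ X) y₀)) hmem
    rw [← key] at hmem
    rw [Multiset.mem_nsmul] at hmem
    have hmem := hmem.2
    rw [Multiset.insert_eq_cons, Multiset.mem_cons, Multiset.mem_singleton] at hmem
    rcases hmem with hm | hm
    · rw [hm]; exact collapse_eq_mk hy h0 h1 hm
    · rw [hm]; exact collapse_eq_mk hy h1 h2 hm
  · exact hcut _ (by simp [Finset.insert_subset_iff, h0, h1]) (card_cycleEdges_filter_pair hf j)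
  · exact hcut _ (by simp [Finset.insert_subset_iff, h1, h2])
      (card_cycleEdges_filter_pair hf (j + 1))
  · exact hcut _ (by simp [Finset.insert_subset_iff, h0, h1, h2])
      (card_cycleEdges_filter_triple hf j)

end Collapse

/-- Adjacent vertices of a chain of sausages of order at least three have a third vertex
of the chain next to them. -/
theorem ChainOfSausages.exists_consecutive {G : MG V} {X : Finset V} {k : ℕ}
    (h : ChainOfSausages G X k) (hk : 3 ≤ k) {a b : V} (ha : a ∈ X) (hb : b ∈ X)
    (hab : s(a, b) ∈ G.edges) :
    ∃ c, Consecutive G a b c ∨ Consecutive G b a c := by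
  obtain ⟨hX, -, -, y₀, hy₀, f, hf, hverts, he⟩ := h
  have hy : y₀ ∉ X := (Finset.mem_sdiff.1 hy₀).2
  have hmem : ∀ i, f i ≠ y₀ → f i ∈ X := by
    intro i hi
    have : f i ∈ (mapGraph (collapseFun (G.verts \ X) y₀) G).verts :=
      hverts ▸ Finset.mem_image_of_mem f (Finset.mem_univ i)
    obtain ⟨v, hv, hvi⟩ := Finset.mem_image.1 this
    unfold collapseFun at hvi
    split_ifs at hvi with hvX
    · exact absurd hvi.symm hi
    · rw [← hvi]
      simpa [hv] using hvX
  have hab' : s(a, b) ∈ cycleEdges (k + 1) f := by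
    have : s(a, b) ∈ (mapGraph (collapseFun (G.verts \ X) y₀) G).edges := by
      refine Multiset.mem_filter.2 ⟨Multiset.mem_map.2 ⟨s(a, b), hab, ?_⟩, G.loopless _ hab⟩
      rw [Sym2.map_mk, collapseFun_eq_self ha, collapseFun_eq_self hb]
    rw [he, Multiset.mem_nsmul] at this
    exact this.2
  rw [cycleEdges_succ, Multiset.mem_map] at hab'
  obtain ⟨j, -, hj⟩ := hab'
  obtain ⟨i, rfl⟩ : ∃ i, j = i + 1 := ⟨j - 1, by simp⟩
  have hends : f i ≠ f (i + 1 + 1 + 1) := by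
    intro h
    have h := hf h
    rw [add_assoc, add_assoc] at h
    have h := left_eq_add.1 h
    have h := congrArg Fin.val h
    rw [Fin.val_add, Fin.val_add, Fin.val_one', Nat.mod_eq_of_lt (by omega : 1 < k + 1),
      Nat.mod_eq_of_lt (by omega : 1 + 1 < k + 1), Nat.mod_eq_of_lt (by omega)] at h
    simp at h
  have hjX : f (i + 1) ∈ X ∧ f (i + 1 + 1) ∈ X := by
    rcases Sym2.eq_iff.1 hj with ⟨h1, h2⟩ | ⟨h1, h2⟩ <;> rw [h1, h2] <;> exact ⟨‹_›, ‹_›⟩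
  obtain ⟨c, hc⟩ : ∃ c, Consecutive G (f (i + 1)) (f (i + 1 + 1)) c ∨
      Consecutive G (f (i + 1 + 1)) (f (i + 1)) c := by
    by_cases hi : f i = y₀
    · exact ⟨_, .inl <| consecutive_of_collapse hX hy (by omega) hf he _ hjX.1 hjX.2
        (hmem _ fun h => hends (hi.trans h.symm))⟩
    · exact ⟨_, .inr <| (consecutive_of_collapse hX hy (by omega) hf he _ (hmem _ hi)
        hjX.1 hjX.2).symm⟩
  rcases Sym2.eq_iff.1 hj with ⟨h1, h2⟩ | ⟨h1, h2⟩ <;> rw [h1, h2] at hc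
  · exact ⟨c, hc⟩
  · exact ⟨c, hc.symm⟩

/-- A single sausage shortening preserves rooted immersions of `W₄`. -/
theorem RootedShortStep.hasRootedW4Immersion {p q : MG V × V} (h : RootedShortStep p q)
    (himm : HasRootedW4Immersion p.1 p.2) : HasRootedW4Immersion q.1 q.2 := by
  obtain ⟨X, k, a, b, hk, hX, ha, hb, hne, hab, hq1, hq2⟩ := h
  obtain ⟨φ, hφ0, hφ⟩ := himm
  rw [hq1, hq2]
  by_cases hterm : (∃ i, φ i = a) ∧ ∃ j, φ j = b
  · obtain ⟨⟨i, rfl⟩, j, rfl⟩ := hterm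
    obtain ⟨c, hc | hc⟩ := hX.exists_consecutive hk ha hb hab
    · obtain ⟨-, hj, hnc⟩ := hc.terminals hφ
      have hroot : p.2 ≠ φ j := by rw [← hφ0]; exact fun e => hj (hφ.1 e).symm
      rw [hc.mapGraph_identify, if_neg hroot]
      refine ⟨_, ?_, hφ.mapGraph _ ?_⟩
      · simp [hφ0, hroot]
      · intro s t hst
        simp only [Function.comp_apply] at hst
        split_ifs at hst with h1 h2 h2
        · exact hφ.1 (h1.trans h2.symm)
        · exact absurd hst.symm (hnc t)
        · exact absurd hst (hnc s)
        · exact hφ.1 hst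
    · obtain ⟨hj, hi, hnc⟩ := hc.terminals hφ
      have hroot : p.2 ≠ φ j := by rw [← hφ0]; exact fun e => hj (hφ.1 e).symm
      have hroot' : p.2 ≠ φ i := by rw [← hφ0]; exact fun e => hi (hφ.1 e).symm
      rw [hc.mapGraph_shift, if_neg hroot]
      refine ⟨_, ?_, hφ.mapGraph _ ?_⟩
      · simp [hφ0, hroot, hroot']
      · intro s t hst
        have hs := hnc s
        have ht := hnc t
        have hi := hnc i
        apply hφ.1
        simp only [Function.comp_apply] at hst
        split_ifs at hst <;> simp_all
  · refine ⟨_, ?_, hφ.mapGraph _ ?_⟩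
    · simp [hφ0]
    · intro s t hst
      apply hφ.1
      simp only [Function.comp_apply] at hst
      split_ifs at hst with h1 h2 h2
      · exact h1.trans h2.symm
      · exact absurd ⟨⟨t, hst.symm⟩, s, h1⟩ hterm
      · exact absurd ⟨⟨s, hst⟩, t, h2⟩ hterm
      · exact hst

/-- Let `G` be a graph with root `x` that has a rooted immersion of
`W₄`.  Then any sausage reduction `H` of `G` (obtained by repeatedly performing
sausage shortenings, carrying the root along, until none is possible) also has a
rooted immersion of `W₄`. -/
theorem statement_13 {V : Type} (G H : MG V) (x y : V)
    (himm : HasRootedW4Immersion G x)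
    (hred : Relation.ReflTransGen RootedShortStep (G, x) (H, y))
    (hfinal : SausageReduced H) :
    HasRootedW4Immersion H y := by
  suffices ∀ q : MG V × V, Relation.ReflTransGen RootedShortStep (G, x) q →
      HasRootedW4Immersion q.1 q.2 from this _ hred
  intro q hq
  induction hq with
  | refl => exact himm
  | tail _ hstep ih => exact hstep.hasRootedW4Immersion ih

end PaperW4
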